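/- Let A be an atomic weakly associative relation algebra, let (B(A), T_κ, E_{κλ})_{κ,λ<3} be the suitable structure built from A, and let t ∈ B(A). Then: (i) E₁₀ ∩ T*₀({t}) = {(t₀, t₀, dom(t₀))}; (ii) E₀₁ ∩ T*₁({t}) = {(t₁, t₁, dom(t₁))}; (iii) E₁₂ ∩ T*₂({t}) = {(rng(t₂), t₂, t₂)}; (iv) E₂₁ ∩ T*₁({t}) = {(rng(t₁), t₁, t₁)}; (v) E₀₂ ∩ T*₂({t}) = {(t₂⌣, dom(t₂), t₂)}; (vi) E₂₀ ∩ T*₀({t}) = {(t₀, rng(t₀), t₀⌣)}. -/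

import Mathlib

universe u

/-- A weakly associative relation algebra: a Boolean algebra equipped with
relative multiplication `comp`, converse `conv`, and identity `one'`
satisfying the WA axioms. -/
structure WA (A : Type*) [BooleanAlgebra A] where
  comp : A → A → A
  conv : A → A
  one' : A
  wassoc : ∀ x : A, comp (comp (x ⊓ one') ⊤) ⊤ = comp (x ⊓ one') ⊤
  rdist : ∀ x y z : A, comp (x ⊔ y) z = comp x z ⊔ comp y z
  comp_one' : ∀ x : A, comp x one' = x
  conv_conv : ∀ x : A, conv (conv x) = x
  conv_sup : ∀ x y : A, conv (x ⊔ y) = conv x ⊔ conv y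
  conv_comp : ∀ x y : A, conv (comp x y) = comp (conv y) (conv x)
  tarski : ∀ x y : A, comp (conv x) (comp x y)ᶜ ≤ yᶜ

variable {A : Type u}

/-- The base set of the suitable structure of an atomic WA:
triples of atoms `s` with `s 1 ≤ s 2 ; s 0`. -/
def BAset [BooleanAlgebra A] (W : WA A) : Set (Fin 3 → A) :=
  {s | (∀ i : Fin 3, IsAtom (s i)) ∧ s 1 ≤ W.comp (s 2) (s 0)}

/-- The relation `T_κ = {(s,t) ∈ B(A)×B(A) : s κ = t κ}`. -/
def Tk [BooleanAlgebra A] (W : WA A) (κ : Fin 3) :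
    Set ((Fin 3 → A) × (Fin 3 → A)) :=
  {p | p.1 ∈ BAset W ∧ p.2 ∈ BAset W ∧ p.1 κ = p.2 κ}

/-- The sets `E_{κλ}`: all of `B(A)` when `κ = λ`, and otherwise the triples
whose entry at the third index `μ ∉ {κ,λ}` is a subidentity atom. -/
def Ee [BooleanAlgebra A] (W : WA A) (κ lam : Fin 3) : Set (Fin 3 → A) :=
  if κ = lam then BAset W
  else {s | s ∈ BAset W ∧ ∀ μ : Fin 3, μ ≠ κ → μ ≠ lam → s μ ≤ W.one'}

/-- The operator `T*_κ(X) = {s ∈ B(A) : s κ = t κ for some t ∈ X}`. -/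
def Tstar [BooleanAlgebra A] (W : WA A) (κ : Fin 3) (X : Set (Fin 3 → A)) :
    Set (Fin 3 → A) :=
  {s | s ∈ BAset W ∧ ∃ t ∈ X, s κ = t κ}

/-- `dom(x) = (x;x⌣)·1'`. -/
def Dom [BooleanAlgebra A] (W : WA A) (x : A) : A :=
  W.comp x (W.conv x) ⊓ W.one'

/-- `rng(x) = (x⌣;x)·1'`. -/
def Rng [BooleanAlgebra A] (W : WA A) (x : A) : A :=
  W.comp (W.conv x) x ⊓ W.one'

namespace WA

theorem eq_vec {s : Fin 3 → A} {a b c : A} (h₀ : s 0 = a) (h₁ : s 1 = b) (h₂ : s 2 = c) :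
    s = ![a, b, c] := by
  ext i
  fin_cases i <;> assumption

variable [BooleanAlgebra A] (W : WA A)

theorem conv_mono : Monotone W.conv := fun x y h => by
  rw [← sup_eq_right.2 h, W.conv_sup]
  exact le_sup_left

theorem comp_mono_left {x y : A} (h : x ≤ y) (z : A) : W.comp x z ≤ W.comp y z := by
  rw [← sup_eq_right.2 h, W.rdist]
  exact le_sup_left

theorem comp_eq_conv (x y : A) : W.comp x y = W.conv (W.comp (W.conv y) (W.conv x)) := by
  rw [← W.conv_comp, W.conv_conv]

theorem comp_mono_right (z : A) {x y : A} (h : x ≤ y) : W.comp z x ≤ W.comp z y := by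
  rw [W.comp_eq_conv z x, W.comp_eq_conv z y]
  exact W.conv_mono (W.comp_mono_left (W.conv_mono h) _)

theorem comp_sup (x y z : A) : W.comp x (y ⊔ z) = W.comp x y ⊔ W.comp x z := by
  rw [W.comp_eq_conv, W.conv_sup, W.rdist, W.conv_sup, ← W.comp_eq_conv, ← W.comp_eq_conv]

theorem conv_one' : W.conv W.one' = W.one' := by
  have h := W.conv_comp (W.conv W.one') W.one'
  rwa [W.comp_one', W.conv_conv, W.comp_one', eq_comm] at h

theorem one'_comp (x : A) : W.comp W.one' x = x := by
  rw [W.comp_eq_conv, W.conv_one', W.comp_one', W.conv_conv]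

/-- The order automorphism of the underlying Boolean algebra given by converse. -/
def convIso : A ≃o A where
  toFun := W.conv
  invFun := W.conv
  left_inv := W.conv_conv
  right_inv := W.conv_conv
  map_rel_iff' := by
    intro x y
    refine ⟨fun h => ?_, fun h => W.conv_mono h⟩
    simpa only [Equiv.coe_fn_mk, W.conv_conv] using W.conv_mono h

theorem isAtom_conv {a : A} (ha : IsAtom a) : IsAtom (W.conv a) :=
  (W.convIso.isAtom_iff a).2 ha

theorem disjoint_conv {x y : A} : Disjoint (W.conv x) (W.conv y) ↔ Disjoint x y :=
  disjoint_map_orderIso_iff W.convIso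

theorem disjoint_comp_right {x y z : A} :
    Disjoint (W.comp x y) z ↔ Disjoint y (W.comp (W.conv x) z) := by
  have key : ∀ {x y z : A}, Disjoint (W.comp x y) z → Disjoint y (W.comp (W.conv x) z) := by
    intro x y z h
    exact le_compl_iff_disjoint_left.1
      ((W.comp_mono_right _ (le_compl_iff_disjoint_left.2 h)).trans (W.tarski x y))
  refine ⟨key, fun h => ?_⟩
  have h' := key h.symm
  rw [W.conv_conv] at h'
  exact h'.symm

theorem disjoint_comp_left {x y z : A} :
    Disjoint (W.comp x y) z ↔ Disjoint x (W.comp z (W.conv y)) := by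
  rw [← W.disjoint_conv, W.conv_comp, W.disjoint_comp_right, ← W.disjoint_conv, W.conv_conv,
    W.conv_comp, W.conv_conv, W.conv_conv]

theorem disjoint_comp_top_of_le_one' {e f : A} (he : e ≤ W.one') (hf : f ≤ W.one')
    (h : Disjoint e f) : Disjoint (W.comp e ⊤) f := by
  rw [← sup_compl_eq_top (x := W.one'), W.comp_sup, W.comp_one', disjoint_sup_left]
  refine ⟨h, Disjoint.mono ?_ hf disjoint_compl_left⟩
  exact (W.comp_mono_left he _).trans (W.one'_comp _).le

theorem disjoint_comp_top_comp_top {e f : A} (he : e ≤ W.one') (hf : f ≤ W.one')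
    (h : Disjoint e f) : Disjoint (W.comp e ⊤) (W.comp f ⊤) := by
  refine Disjoint.symm (W.disjoint_comp_left.2 ?_)
  have hw := W.wassoc e
  rw [inf_eq_left.2 he] at hw
  refine Disjoint.mono_right ((W.comp_mono_right _ le_top).trans hw.le) ?_
  exact (W.disjoint_comp_top_of_le_one' he hf h).symm

theorem le_comp_of_le_dom {a e : A} (ha : IsAtom a) (he : e ≠ ⊥) (h : e ≤ Dom W a) :
    a ≤ W.comp e a := by
  refine ha.not_disjoint_iff_le.1 fun hd => he ?_
  exact (W.disjoint_comp_left.1 hd.symm).eq_bot_of_le (h.trans inf_le_left)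

theorem dom_ne_bot {a : A} (ha : IsAtom a) : Dom W a ≠ ⊥ := fun h => by
  have hd : Disjoint (W.comp W.one' a) a :=
    W.disjoint_comp_left.2 (disjoint_iff.2 h).symm
  rw [W.one'_comp, disjoint_self] at hd
  exact ha.1 hd

theorem isAtom_dom {a : A} (ha : IsAtom a) : IsAtom (Dom W a) := by
  refine ⟨W.dom_ne_bot ha, fun b hb => ?_⟩
  by_contra hb0
  have hf0 : Dom W a \ b ≠ ⊥ := fun h => hb.not_ge (sdiff_eq_bot_iff.1 h)
  have hd := W.disjoint_comp_top_comp_top (hb.le.trans inf_le_right)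
    ((sdiff_le : Dom W a \ b ≤ _).trans inf_le_right) disjoint_sdiff_self_right
  have h₁ := (W.le_comp_of_le_dom ha hb0 hb.le).trans (W.comp_mono_right _ le_top)
  have h₂ := (W.le_comp_of_le_dom ha hf0 sdiff_le).trans (W.comp_mono_right _ le_top)
  exact ha.1 (le_bot_iff.1 (hd h₁ h₂))

theorem dom_conv (a : A) : Dom W (W.conv a) = Rng W a := by
  rw [Dom, Rng, W.conv_conv]

theorem conv_dom (a : A) : W.conv (Dom W a) = Dom W a := by
  have h : W.conv (Dom W a) ≤ Dom W a := by
    refine le_inf ((W.conv_mono inf_le_left).trans ?_) ((W.conv_mono inf_le_right).trans ?_)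
    · rw [W.conv_comp, W.conv_conv]
    · rw [W.conv_one']
  refine le_antisymm h ?_
  simpa only [W.conv_conv] using W.conv_mono h

theorem le_dom_comp {a : A} (ha : IsAtom a) : a ≤ W.comp (Dom W a) a :=
  W.le_comp_of_le_dom ha (W.dom_ne_bot ha) le_rfl

theorem isAtom_rng {a : A} (ha : IsAtom a) : IsAtom (Rng W a) := by
  rw [← W.dom_conv]
  exact W.isAtom_dom (W.isAtom_conv ha)

theorem le_comp_rng {a : A} (ha : IsAtom a) : a ≤ W.comp a (Rng W a) := by
  rw [W.comp_eq_conv, ← W.dom_conv, W.conv_dom]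
  simpa only [W.conv_conv] using W.conv_mono (W.le_dom_comp (W.isAtom_conv ha))

theorem eq_dom_of_le_comp_conv {a e : A} (ha : IsAtom a) (he : IsAtom e) (h1 : e ≤ W.one')
    (h : e ≤ W.comp a (W.conv a)) : e = Dom W a :=
  ((W.isAtom_dom ha).le_iff_eq he.1).1 (le_inf h h1)

/-- An atomic triple with subidentity last entry is determined by either other entry. -/
theorem eq_and_eq_dom {a b e : A} (ha : IsAtom a) (hb : IsAtom b) (he : IsAtom e)
    (h1 : e ≤ W.one') (h : b ≤ W.comp e a) : b = a ∧ e = Dom W a := by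
  have hba : b = a :=
    (ha.le_iff_eq hb.1).1 (h.trans ((W.comp_mono_left h1 a).trans (W.one'_comp a).le))
  subst hba
  refine ⟨rfl, W.eq_dom_of_le_comp_conv ha he h1 (he.not_disjoint_iff_le.1 fun hd => ?_)⟩
  exact hb.1 ((W.disjoint_comp_left.2 hd).symm.eq_bot_of_le h)

/-- An atomic triple with subidentity first entry is determined by either other entry. -/
theorem eq_and_eq_rng {a b e : A} (ha : IsAtom a) (hb : IsAtom b) (he : IsAtom e)
    (h1 : e ≤ W.one') (h : b ≤ W.comp a e) : b = a ∧ e = Rng W a := by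
  have hba : b = a :=
    (ha.le_iff_eq hb.1).1 (h.trans ((W.comp_mono_right a h1).trans (W.comp_one' a).le))
  subst hba
  refine ⟨rfl, ?_⟩
  rw [← W.dom_conv]
  refine W.eq_dom_of_le_comp_conv (W.isAtom_conv ha) he h1 ?_
  rw [W.conv_conv]
  refine he.not_disjoint_iff_le.1 fun hd => ?_
  exact hb.1 ((W.disjoint_comp_right.2 hd).symm.eq_bot_of_le h)

/-- An atomic triple with subidentity middle entry is determined by either other entry. -/
theorem eq_conv_and_eq_dom {a b e : A} (ha : IsAtom a) (hb : IsAtom b) (he : IsAtom e)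
    (h1 : e ≤ W.one') (h : e ≤ W.comp a b) : b = W.conv a ∧ e = Dom W a := by
  have hba : b = W.conv a := by
    refine ((W.isAtom_conv ha).le_iff_eq hb.1).1 ?_
    have hle : b ≤ W.comp (W.conv a) e := hb.not_disjoint_iff_le.1 fun hd =>
      he.1 ((W.disjoint_comp_right.2 hd).symm.eq_bot_of_le h)
    exact hle.trans ((W.comp_mono_right _ h1).trans (W.comp_one' _).le)
  subst hba
  exact ⟨rfl, W.eq_dom_of_le_comp_conv ha he h1 h⟩

theorem mem_Ee_inter_Tstar {κ lam μ : Fin 3} (hκ : μ ≠ κ) (hlam : μ ≠ lam) (hne : κ ≠ lam)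
    (ν : Fin 3) {s t : Fin 3 → A} :
    s ∈ Ee W κ lam ∩ Tstar W ν {t} ↔ s ∈ BAset W ∧ s μ ≤ W.one' ∧ s ν = t ν := by
  have hμ : ∀ i, i ≠ κ → i ≠ lam → i = μ := by omega
  simp only [Ee, if_neg hne, Tstar, Set.mem_inter_iff, Set.mem_ofPred_eq, Set.mem_singleton_iff,
    exists_eq_left]
  constructor
  · rintro ⟨⟨hs, h⟩, -, h'⟩
    exact ⟨hs, h μ hκ hlam, h'⟩
  · rintro ⟨hs, h, h'⟩
    exact ⟨⟨hs, fun i h₁ h₂ => hμ i h₁ h₂ ▸ h⟩, hs, h'⟩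

theorem mem_BAset {a b c : A} (ha : IsAtom a) (hb : IsAtom b) (hc : IsAtom c)
    (h : b ≤ W.comp c a) : ![a, b, c] ∈ BAset W :=
  ⟨by simp [Fin.forall_fin_succ, ha, hb, hc], h⟩

end WA

/-- The six "functionality" identities for the suitable structure. -/
theorem stmt_9 [BooleanAlgebra A] (W : WA A)
    (hatomic : ∀ x : A, x ≠ ⊥ → ∃ a : A, IsAtom a ∧ a ≤ x)
    (t : Fin 3 → A) (ht : t ∈ BAset W) :
    Ee W 1 0 ∩ Tstar W 0 {t} = {![t 0, t 0, Dom W (t 0)]} ∧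
    Ee W 0 1 ∩ Tstar W 1 {t} = {![t 1, t 1, Dom W (t 1)]} ∧
    Ee W 1 2 ∩ Tstar W 2 {t} = {![Rng W (t 2), t 2, t 2]} ∧
    Ee W 2 1 ∩ Tstar W 1 {t} = {![Rng W (t 1), t 1, t 1]} ∧
    Ee W 0 2 ∩ Tstar W 2 {t} = {![W.conv (t 2), Dom W (t 2), t 2]} ∧
    Ee W 2 0 ∩ Tstar W 0 {t} = {![t 0, Rng W (t 0), W.conv (t 0)]} := by
  have ha := ht.1
  refine ⟨?_, ?_, ?_, ?_, ?_, ?_⟩ <;> ext s <;> rw [Set.mem_singleton_iff]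
  · rw [W.mem_Ee_inter_Tstar (μ := 2) (by decide) (by decide) (by decide)]
    constructor
    · rintro ⟨⟨hs, h⟩, h1, h'⟩
      obtain ⟨h₁, h₂⟩ := W.eq_and_eq_dom (hs 0) (hs 1) (hs 2) h1 h
      exact WA.eq_vec h' (h₁.trans h') (h₂.trans (by rw [h']))
    · rintro rfl
      exact ⟨W.mem_BAset (ha 0) (ha 0) (W.isAtom_dom (ha 0)) (W.le_dom_comp (ha 0)),
        inf_le_right, rfl⟩
  · rw [W.mem_Ee_inter_Tstar (μ := 2) (by decide) (by decide) (by decide)]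
    constructor
    · rintro ⟨⟨hs, h⟩, h1, h'⟩
      obtain ⟨h₁, h₂⟩ := W.eq_and_eq_dom (hs 0) (hs 1) (hs 2) h1 h
      exact WA.eq_vec (h₁.symm.trans h') h' (h₂.trans (by rw [← h₁, h']))
    · rintro rfl
      exact ⟨W.mem_BAset (ha 1) (ha 1) (W.isAtom_dom (ha 1)) (W.le_dom_comp (ha 1)),
        inf_le_right, rfl⟩
  · rw [W.mem_Ee_inter_Tstar (μ := 0) (by decide) (by decide) (by decide)]
    constructor
    · rintro ⟨⟨hs, h⟩, h1, h'⟩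
      obtain ⟨h₁, h₂⟩ := W.eq_and_eq_rng (hs 2) (hs 1) (hs 0) h1 h
      exact WA.eq_vec (h₂.trans (by rw [h'])) (h₁.trans h') h'
    · rintro rfl
      exact ⟨W.mem_BAset (W.isAtom_rng (ha 2)) (ha 2) (ha 2) (W.le_comp_rng (ha 2)),
        inf_le_right, rfl⟩
  · rw [W.mem_Ee_inter_Tstar (μ := 0) (by decide) (by decide) (by decide)]
    constructor
    · rintro ⟨⟨hs, h⟩, h1, h'⟩
      obtain ⟨h₁, h₂⟩ := W.eq_and_eq_rng (hs 2) (hs 1) (hs 0) h1 h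
      exact WA.eq_vec (h₂.trans (by rw [← h₁, h'])) h' (h₁.symm.trans h')
    · rintro rfl
      exact ⟨W.mem_BAset (W.isAtom_rng (ha 1)) (ha 1) (ha 1) (W.le_comp_rng (ha 1)),
        inf_le_right, rfl⟩
  · rw [W.mem_Ee_inter_Tstar (μ := 1) (by decide) (by decide) (by decide)]
    constructor
    · rintro ⟨⟨hs, h⟩, h1, h'⟩
      obtain ⟨h₁, h₂⟩ := W.eq_conv_and_eq_dom (hs 2) (hs 0) (hs 1) h1 h
      exact WA.eq_vec (h₁.trans (by rw [h'])) (h₂.trans (by rw [h'])) h'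
    · rintro rfl
      exact ⟨W.mem_BAset (W.isAtom_conv (ha 2)) (W.isAtom_dom (ha 2)) (ha 2) inf_le_left,
        inf_le_right, rfl⟩
  · rw [W.mem_Ee_inter_Tstar (μ := 1) (by decide) (by decide) (by decide)]
    constructor
    · rintro ⟨⟨hs, h⟩, h1, h'⟩
      obtain ⟨h₁, h₂⟩ := W.eq_conv_and_eq_dom (hs 2) (hs 0) (hs 1) h1 h
      have h₃ : s 2 = W.conv (t 0) := by rw [← h', h₁, W.conv_conv]
      exact WA.eq_vec h' (h₂.trans (by rw [h₃, W.dom_conv])) h₃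
    · rintro rfl
      exact ⟨W.mem_BAset (ha 0) (W.isAtom_rng (ha 0)) (W.isAtom_conv (ha 0)) inf_le_left,
        inf_le_right, rfl⟩
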